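/- Fix k_1 ≥ 1, k_2 ≥ 2, s_1 ≥ 2, set k := k_1 + s_1(k_2−1) and n^* := ⌊(k−1)/s_1⌋. For P = Σ_{j=0}^{k−1} A_j x^{k−1−j} y^j ∈ ℂ[x,y], let (p_1,…,p_{s_1}) = σ_{s_1}(P) and let q_i ∈ ℂ[x,y] be obtained from p_i by the substitution x^{s_1} → x, y^{s_1} → y, regarded as a binary form of formal degree n_i := ⌊(k−i)/s_1⌋ (each n_i equals n^* or n^*−1; let r be the number of indices i with n_i = n^*). Let R_{l_1} be the resultant matrix of q_1,…,q_{s_1} (with formal degrees n_i) for l_1 = 2n^* − k_2, and R_{l_2} the resultant matrix of q_1,…,q_r for l_2 = 2n^* − k_2 + 1. Then P ∈ F((k_1,k_2),(s_1,1)) if and only if every minor of size 2n^* − 2k_2 + 3 of R_{l_1} vanishes and every minor of size 2n^* − 2k_2 + 4 of R_{l_2} vanishes. -/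

import Mathlib

/-- All monomials of `P` involve only `x^s` and `y^s`. -/
def MonoS (s : ℕ) (P : MvPolynomial (Fin 2) ℂ) : Prop :=
  ∀ m ∈ P.support, s ∣ m 0 ∧ s ∣ m 1

/-- `S ℓ = s_1 ⋯ s_{ℓ-1}` (0-indexed: `Sp s i = ∏_{j<i} s j`, so `Sp s 0 = 1`). -/
def Sp (s : ℕ → ℕ) (i : ℕ) : ℕ := ∏ j ∈ Finset.range i, s j

/-- `F(k,s)`: homogeneous polynomials of degree `k-1` admitting a factorization
`P = P_L ⋯ P_1`, where `P_ℓ` is homogeneous of degree `S_ℓ(k_ℓ-1)` with all monomials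
in `x^{S_ℓ}, y^{S_ℓ}` (layers are 0-indexed here). -/
def Fset (L : ℕ) (k s : ℕ → ℕ) : Set (MvPolynomial (Fin 2) ℂ) :=
  { P | ∃ Q : ℕ → MvPolynomial (Fin 2) ℂ, P = ∏ i ∈ Finset.range L, Q i ∧
      ∀ i < L, (Q i).IsHomogeneous (Sp s i * (k i - 1)) ∧ MonoS (Sp s i) (Q i) }

/-- `p` is the `s`-decomposition `σ_s(P)` of the homogeneous polynomial `P` of degree `m`. -/
def IsSigma (s m : ℕ) (P : MvPolynomial (Fin 2) ℂ)
    (p : Fin s → MvPolynomial (Fin 2) ℂ) : Prop :=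
  (∀ i : Fin s, (p i).IsHomogeneous (s * ((m - i.val) / s)) ∧ MonoS s (p i) ∧
      (m < i.val → p i = 0)) ∧
  P = ∑ i : Fin s,
    MvPolynomial.X 0 ^ i.val * MvPolynomial.X 1 ^ ((m - i.val) % s) * p i

/-- The coefficient of `x^a y^b` in a binary form `q ∈ ℂ[x,y]`. -/
noncomputable def coeffOf (q : MvPolynomial (Fin 2) ℂ) (a b : ℕ) : ℂ :=
  MvPolynomial.coeff (Finsupp.single 0 a + Finsupp.single 1 b) q

/-- The resultant matrix `R_l` of the binary forms `q i` of (formal) degrees `n i`. -/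
noncomputable def resMat {ι : Type} [Fintype ι] (n : ι → ℕ)
    (q : ι → MvPolynomial (Fin 2) ℂ) (l : ℕ) :
    Matrix ((i : ι) × Fin (l + 1 - n i)) (Fin (l + 1)) ℂ :=
  fun r c =>
    if r.2.val ≤ c.val ∧ c.val - r.2.val ≤ n r.1
      then coeffOf (q r.1) (n r.1 - (c.val - r.2.val)) (c.val - r.2.val) else 0

/-- A family of rows spanning dimension at least `z` contains `z` independent ones. -/
lemma exists_linearIndependent_fin {K V ι : Type*} [Field K] [AddCommGroup V] [Module K V]
    [Finite ι] (v : ι → V) (z : ℕ) (hz : z ≤ Module.finrank K (Submodule.span K (Set.range v))) :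
    ∃ a : Fin z → ι, LinearIndependent K (v ∘ a) := by
  obtain ⟨κ, a, ha, hsp, hli⟩ := exists_linearIndependent' K v
  have : Finite κ := Finite.of_injective a ha
  have := Fintype.ofFinite κ
  rw [← hsp, finrank_span_eq_card hli] at hz
  let e := (Fintype.equivFin κ).symm
  refine ⟨fun i => a (e (Fin.castLE hz i)), ?_⟩
  exact hli.comp (fun i => e (Fin.castLE hz i)) (e.injective.comp (Fin.castLE_injective hz))

/-- All minors of size `z` vanish exactly when the rank is less than `z`. -/
lemma Matrix.forall_minor_eq_zero_iff {K m n : Type*} [Field K] [Finite m] [Fintype n]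
    (M : Matrix m n K) (z : ℕ) :
    (∀ (ri : Fin z → m) (ci : Fin z → n), (M.submatrix ri ci).det = 0) ↔ M.rank < z := by
  classical
  constructor
  · intro h
    by_contra! hz
    rw [M.rank_eq_finrank_span_row] at hz
    obtain ⟨ri, hri⟩ := exists_linearIndependent_fin (K := K) M.row z hz
    have h1 : (M.submatrix ri id).rank = z := by
      have := LinearIndependent.rank_matrix (M := M.submatrix ri id) hri
      simpa using this
    rw [Matrix.rank_eq_finrank_span_cols] at h1
    obtain ⟨ci, hci⟩ := exists_linearIndependent_fin (K := K) (M.submatrix ri id).col z h1.ge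
    have h2 : LinearIndependent K (M.submatrix ri ci).col := hci
    have h3 := (Matrix.linearIndependent_cols_iff_isUnit.1 h2)
    rw [Matrix.isUnit_iff_isUnit_det, h ri ci] at h3
    simp at h3
  · intro h ri ci
    by_contra hd
    have h1 := Matrix.rank_of_det_ne_zero hd
    have h2 := M.rank_submatrix_le ri ci
    simp at h1
    omega

namespace Polynomial

section Gap

variable {K : Type*} [Field K]

instance finiteDimensional_degreeLT (n : ℕ) : FiniteDimensional K (degreeLT K n) :=
  Module.Finite.equiv (degreeLTEquiv K n).symm

lemma finrank_degreeLT (n : ℕ) : Module.finrank K (degreeLT K n) = n := by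
  simp [(degreeLTEquiv K n).finrank_eq]

lemma finrank_map_mulLeft {G : K[X]} (hG : G ≠ 0) (V : Submodule K K[X]) :
    Module.finrank K (V.map (LinearMap.mulLeft K G)) = Module.finrank K V :=
  (V.equivMapOfInjective _ (mul_right_injective₀ hG)).finrank_eq.symm

lemma mul_mem_degreeLT {a b : ℕ} {f g : K[X]} (hf : f.natDegree ≤ a) (hg : g ∈ degreeLT K b) :
    f * g ∈ degreeLT K (a + b) := by
  rcases eq_or_ne g 0 with rfl | h
  · simp
  rw [mem_degreeLT] at *
  rw [← natDegree_lt_iff_degree_lt h] at hg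
  refine (degree_le_natDegree.trans (Nat.cast_le.2 natDegree_mul_le)).trans_lt ?_
  exact Nat.cast_lt.2 (by omega)

/-- Multiplication of a space of binary forms, in dehomogenized form, by the linear forms. -/
noncomputable def linMul (V : Submodule K K[X]) : Submodule K K[X] :=
  V ⊔ V.map (LinearMap.mulLeft K X)

lemma linMul_le_degreeLT {V : Submodule K K[X]} {N : ℕ} (hV : V ≤ degreeLT K N) :
    linMul V ≤ degreeLT K (N + 1) := by
  refine sup_le (hV.trans (degreeLT_mono (Nat.le_succ N))) ?_
  rintro _ ⟨f, hf, rfl⟩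
  rw [add_comm]
  exact mul_mem_degreeLT (by simp) (hV hf)

lemma finiteDimensional_of_le_degreeLT {V : Submodule K K[X]} {N : ℕ} (hV : V ≤ degreeLT K N) :
    FiniteDimensional K V := Submodule.finiteDimensional_of_le hV

lemma finrank_lt_linMul {V : Submodule K K[X]} {N : ℕ} (hV : V ≤ degreeLT K N) (h0 : V ≠ ⊥) :
    Module.finrank K V < Module.finrank K (linMul V) := by
  have := finiteDimensional_of_le_degreeLT (linMul_le_degreeLT hV)
  refine Submodule.finrank_lt_finrank_of_lt (lt_of_le_of_ne le_sup_left fun h => ?_)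
  obtain ⟨f, hf, hf0⟩ := Submodule.exists_mem_ne_zero_of_ne_bot h0
  have hX : ∀ g ∈ V, X * g ∈ V := fun g hg => by
    have : X * g ∈ linMul V := (le_sup_right : _ ≤ linMul V) ⟨g, hg, rfl⟩
    rwa [← h] at this
  have hpow : ∀ k : ℕ, X ^ k * f ∈ V := fun k => by
    induction k with
    | zero => simpa using hf
    | succ k ih => rw [pow_succ', mul_assoc]; exact hX _ ih
  have h1 := hV (hpow N)
  rw [mem_degreeLT, ← natDegree_lt_iff_degree_lt (mul_ne_zero (by simp) hf0),
    natDegree_X_pow_mul _ hf0] at h1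
  omega

lemma linMul_map_mulLeft (G : K[X]) (V : Submodule K K[X]) :
    linMul (V.map (LinearMap.mulLeft K G)) = (linMul V).map (LinearMap.mulLeft K G) := by
  simp only [linMul, Submodule.map_sup, ← Submodule.map_comp]
  congr 2
  refine LinearMap.ext fun f => ?_
  simp [mul_left_comm]

lemma linMul_degreeLT {t : ℕ} (ht : 0 < t) :
    linMul (degreeLT K t) = degreeLT K (t + 1) := by
  have h1 := linMul_le_degreeLT (le_refl (degreeLT K t))
  refine Submodule.eq_of_le_of_finrank_le h1 ?_
  have := finrank_lt_linMul (le_refl (degreeLT K t)) (fun h => by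
    have := finrank_degreeLT (K := K) t
    rw [h] at this; simp at this; omega)
  rw [finrank_degreeLT] at *
  omega

/-- A space of polynomials whose product with the linear forms is as small as possible
is a multiple of the space of all polynomials of bounded degree. -/
lemma eq_map_degreeLT_of_finrank_linMul_le (t : ℕ) (V : Submodule K K[X]) {N : ℕ}
    (hV : V ≤ degreeLT K N) (hdim : Module.finrank K V = t + 1)
    (hgap : Module.finrank K (linMul V) ≤ t + 2) :
    ∃ G : K[X], G ≠ 0 ∧ V = (degreeLT K (t + 1)).map (LinearMap.mulLeft K G) := by
  induction t generalizing V with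
  | zero =>
    obtain ⟨G, hG0, hG⟩ := finrank_eq_one_iff'.1 hdim
    refine ⟨G, by simpa using hG0, ?_⟩
    have := finiteDimensional_of_le_degreeLT hV
    refine (Submodule.eq_of_le_of_finrank_le ?_ ?_).symm
    · rintro _ ⟨f, hf, rfl⟩
      rw [SetLike.mem_coe, degreeLT_succ_eq_degreeLE, mem_degreeLE, Nat.cast_zero] at hf
      rw [eq_C_of_degree_le_zero hf, LinearMap.mulLeft_apply, mul_comm, ← smul_eq_C_mul]
      exact V.smul_mem _ G.2
    · rw [finrank_map_mulLeft (by simpa using hG0), finrank_degreeLT, hdim]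
  | succ t ih =>
    have := finiteDimensional_of_le_degreeLT hV
    set V' : Submodule K K[X] := V ⊓ V.comap (LinearMap.mulLeft K X) with hV'
    have hV'V : V' ≤ V := inf_le_left
    have hmap : V'.map (LinearMap.mulLeft K X) = V ⊓ V.map (LinearMap.mulLeft K X) := by
      ext f
      constructor
      · rintro ⟨g, hg, rfl⟩
        exact ⟨hg.2, g, hg.1, rfl⟩
      · rintro ⟨hf, g, hg, rfl⟩
        exact ⟨g, ⟨hg, hf⟩, rfl⟩
    have hsum := Submodule.finrank_sup_add_finrank_inf_eq V (V.map (LinearMap.mulLeft K X))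
    rw [← hmap, finrank_map_mulLeft X_ne_zero, finrank_map_mulLeft X_ne_zero] at hsum
    change Module.finrank K (linMul V) + _ = _ at hsum
    have hle : linMul V' ≤ V := by
      refine sup_le hV'V ?_
      rw [hmap]
      exact inf_le_left
    have hlt := finrank_lt_linMul (hV'V.trans hV) (fun h => by
      rw [h] at hsum; simp at hsum; omega)
    have hle' := Submodule.finrank_mono hle
    have hV'dim : Module.finrank K V' = t + 1 := by omega
    obtain ⟨G, hG, hGV⟩ := ih V' (hV'V.trans hV) hV'dim (by omega)
    refine ⟨G, hG, ?_⟩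
    rw [← Submodule.eq_of_le_of_finrank_le hle (by omega), hGV, linMul_map_mulLeft,
      linMul_degreeLT (Nat.succ_pos t)]

/-- A chain of spaces, each containing the product of the previous one with the linear forms,
whose dimension grows slowly has a step that is a multiple of a full space of polynomials. -/
lemma exists_eq_map_degreeLT_of_chain (T : ℕ → Submodule K K[X]) (N : ℕ → ℕ)
    (hN : ∀ j, T j ≤ degreeLT K (N j)) (hT : ∀ j, linMul (T j) ≤ T (j + 1)) (h0 : T 0 ≠ ⊥) (c : ℕ)
    (hc : Module.finrank K (T c) < Module.finrank K (T 0) + 2 * c) :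
    ∃ (j t : ℕ) (G : K[X]), G ≠ 0 ∧ j < c ∧ t + c ≤ Module.finrank K (T c) + j ∧
      T (j + 1) = (degreeLT K (t + 1)).map (LinearMap.mulLeft K G) := by
  have hfin : ∀ j, FiniteDimensional K (T j) := fun j => finiteDimensional_of_le_degreeLT (hN j)
  have hne : ∀ j, T j ≠ ⊥ := fun j => by
    induction j with
    | zero => exact h0
    | succ j ih => exact ne_bot_of_le_ne_bot ih (le_sup_left.trans (hT j))
  have hstep : ∀ j, Module.finrank K (T j) < Module.finrank K (T (j + 1)) := fun j =>
    (finrank_lt_linMul (hN j) (hne j)).trans_le (Submodule.finrank_mono (hT j))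
  have hgrow : ∀ j m, Module.finrank K (T j) + m ≤ Module.finrank K (T (j + m)) := fun j m => by
    induction m with
    | zero => rfl
    | succ m ih => have := hstep (j + m); rw [← add_assoc j]; omega
  obtain ⟨j, hjc, hj⟩ : ∃ j < c, Module.finrank K (T (j + 1)) ≤ Module.finrank K (T j) + 1 := by
    by_contra! hcon
    have : ∀ m ≤ c, Module.finrank K (T 0) + 2 * m ≤ Module.finrank K (T m) := fun m hm => by
      induction m with
      | zero => rfl
      | succ m ih => have := hcon m hm; have := ih (by omega); omega
    have := this c le_rfl
    omega
  obtain ⟨t, ht⟩ : ∃ t, Module.finrank K (T j) = t + 1 :=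
    Nat.exists_eq_succ_of_ne_zero fun h => hne j (Submodule.finrank_eq_zero.1 h)
  have hlin := finrank_lt_linMul (hN j) (hne j)
  have hlin' := Submodule.finrank_mono (hT j)
  obtain ⟨G, hG, hGT⟩ := eq_map_degreeLT_of_finrank_linMul_le t (T j) (hN j) ht (by omega)
  have hgr := hgrow j (c - j)
  rw [Nat.add_sub_cancel' hjc.le] at hgr
  refine ⟨j, t + 1, G, hG, hjc, by omega, ?_⟩
  rw [← Submodule.eq_of_le_of_finrank_le (hT j) (by omega), hGT, linMul_map_mulLeft,
    linMul_degreeLT (Nat.succ_pos t)]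

/-- The row space of a resultant matrix, as a space of dehomogenized forms: the forms of degree `l`
in the ideal of the forms `f i` of degree `n i`. -/
noncomputable def rowSpace {ι : Type*} (n : ι → ℕ) (f : ι → K[X]) (l : ℕ) : Submodule K K[X] :=
  Submodule.span K (Set.range fun x : (i : ι) × Fin (l + 1 - n i) => X ^ (x.2 : ℕ) * f x.1)

variable {ι : Type*} {n : ι → ℕ} {f : ι → K[X]}

lemma X_pow_mul_mem_rowSpace {l t : ℕ} {i : ι} (h : t + n i ≤ l) :
    X ^ t * f i ∈ rowSpace n f l :=
  Submodule.subset_span ⟨⟨i, ⟨t, by omega⟩⟩, rfl⟩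

lemma rowSpace_le_iff {l : ℕ} {W : Submodule K K[X]} :
    rowSpace n f l ≤ W ↔ ∀ i t, t + n i ≤ l → X ^ t * f i ∈ W := by
  refine ⟨fun h i t ht => h (X_pow_mul_mem_rowSpace ht), fun h => Submodule.span_le.2 ?_⟩
  rintro _ ⟨⟨i, t⟩, rfl⟩
  exact h i t (by omega)

lemma rowSpace_le_degreeLT (hf : ∀ i, f i ∈ degreeLT K (n i + 1)) (l : ℕ) :
    rowSpace n f l ≤ degreeLT K (l + 1) :=
  rowSpace_le_iff.2 fun i t ht =>
    degreeLT_mono (by omega) (mul_mem_degreeLT (natDegree_X_pow_le t) (hf i))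

lemma linMul_rowSpace_le (l : ℕ) : linMul (rowSpace n f l) ≤ rowSpace n f (l + 1) := by
  refine sup_le (rowSpace_le_iff.2 fun i t ht => X_pow_mul_mem_rowSpace (by omega)) ?_
  rw [Submodule.map_le_iff_le_comap]
  refine rowSpace_le_iff.2 fun i t ht => ?_
  rw [Submodule.mem_comap, LinearMap.mulLeft_apply, ← mul_assoc, ← pow_succ']
  exact X_pow_mul_mem_rowSpace (by omega)

/-- If the row spaces grow slowly, then the forms have a common factor of large degree. -/
lemma exists_common_factor_of_finrank_rowSpace_lt (hf : ∀ i, f i ∈ degreeLT K (n i + 1))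
    (l c : ℕ) (hn : ∀ i, n i ≤ l + 1) (h0 : rowSpace n f l ≠ ⊥)
    (hc : Module.finrank K (rowSpace n f (l + c)) < Module.finrank K (rowSpace n f l) + 2 * c) :
    ∃ G : K[X], G ≠ 0 ∧ ∀ i, ∃ g, f i = G * g ∧
      g ∈ degreeLT K (Module.finrank K (rowSpace n f (l + c)) + n i - (c + l)) := by
  obtain ⟨j, t, G, hG, hjc, ht, hT⟩ := exists_eq_map_degreeLT_of_chain
    (fun j => rowSpace n f (l + j)) (fun j => l + j + 1) (fun j => rowSpace_le_degreeLT hf _)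
    (fun j => linMul_rowSpace_le _) h0 c hc
  refine ⟨G, hG, fun i => ?_⟩
  have hi := hn i
  have h1 : X ^ 0 * f i ∈ rowSpace n f (l + (j + 1)) := X_pow_mul_mem_rowSpace (by omega)
  have h2 : X ^ (l + (j + 1) - n i) * f i ∈ rowSpace n f (l + (j + 1)) :=
    X_pow_mul_mem_rowSpace (by omega)
  rw [hT] at h1 h2
  obtain ⟨g, hg, hgf⟩ := h1
  obtain ⟨g', hg', hgf'⟩ := h2
  rw [pow_zero, one_mul, LinearMap.mulLeft_apply] at hgf
  refine ⟨g, hgf.symm, ?_⟩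
  rcases eq_or_ne g 0 with rfl | hg0
  · exact zero_mem _
  have hgg' : g' = X ^ (l + (j + 1) - n i) * g := by
    refine mul_left_cancel₀ hG ?_
    rw [LinearMap.mulLeft_apply] at hgf'
    rw [hgf', ← hgf, mul_left_comm]
  rw [hgg', SetLike.mem_coe, mem_degreeLT,
    ← natDegree_lt_iff_degree_lt (mul_ne_zero (by simp) hg0), natDegree_X_pow_mul _ hg0] at hg'
  rw [mem_degreeLT, ← natDegree_lt_iff_degree_lt hg0]
  omega

lemma exists_dvd_natDegree_eq [IsAlgClosed K] (G : K[X]) (d : ℕ) (hd : d ≤ G.natDegree) :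
    ∃ D, D ∣ G ∧ D.natDegree = d := by
  induction d with
  | zero => exact ⟨1, one_dvd _, natDegree_one⟩
  | succ d ih =>
    obtain ⟨D, ⟨H, rfl⟩, hD⟩ := ih (by omega)
    have h0 : D * H ≠ 0 := fun h => by simp [h] at hd
    have hH0 := right_ne_zero_of_mul h0
    have hD0 := left_ne_zero_of_mul h0
    rw [natDegree_mul hD0 hH0] at hd
    obtain ⟨a, ha⟩ := IsAlgClosed.exists_root H (natDegree_pos_iff_degree_pos.1 (by omega)).ne'
    refine ⟨D * (X - C a), mul_dvd_mul_left D (dvd_iff_isRoot.2 ha), ?_⟩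
    rw [natDegree_mul hD0 (X_sub_C_ne_zero a), natDegree_X_sub_C, hD]

/-- The forms `f i` of degree `n i` have a common factor of degree `d`. -/
def HasCommonFactor (n : ι → ℕ) (f : ι → K[X]) (d : ℕ) : Prop :=
  ∃ D : K[X], D.natDegree ≤ d ∧ ∀ i, ∃ g ∈ degreeLT K (n i + 1 - d), f i = D * g

/-- A common factor can be cut down to one of the prescribed degree. -/
lemma hasCommonFactor_of_dvd [IsAlgClosed K] (hf : ∀ i, f i ∈ degreeLT K (n i + 1)) {d : ℕ}
    {G : K[X]} (hG : G ≠ 0) (hGf : ∀ i, ∃ g, f i = G * g ∧ g ∈ degreeLT K (n i + 1 - d)) :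
    HasCommonFactor n f d := by
  rcases le_total G.natDegree d with h | h
  · exact ⟨G, h, fun i => (hGf i).imp fun g hg => hg.symm⟩
  obtain ⟨D, ⟨H, rfl⟩, hD⟩ := exists_dvd_natDegree_eq G d h
  refine ⟨D, hD.le, fun i => ?_⟩
  obtain ⟨g, hg, -⟩ := hGf i
  refine ⟨H * g, ?_, by rw [hg, mul_assoc]⟩
  rcases eq_or_ne (H * g) 0 with h0 | h0
  · rw [h0]; exact zero_mem _
  have hD0 := left_ne_zero_of_mul hG
  have := hf i
  rw [hg, mul_assoc, mem_degreeLT, ← natDegree_lt_iff_degree_lt (mul_ne_zero hD0 h0),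
    natDegree_mul hD0 h0] at this
  rw [mem_degreeLT, ← natDegree_lt_iff_degree_lt h0]
  omega

lemma HasCommonFactor.finrank_rowSpace_le {d : ℕ} (h : HasCommonFactor n f d) (l : ℕ) :
    Module.finrank K (rowSpace n f l) ≤ l + 1 - d := by
  obtain ⟨D, -, hD⟩ := h
  have hle : rowSpace n f l ≤ (degreeLT K (l + 1 - d)).map (LinearMap.mulLeft K D) := by
    refine rowSpace_le_iff.2 fun i t ht => ?_
    obtain ⟨g, hg, hfg⟩ := hD i
    refine ⟨X ^ t * g, ?_, by rw [hfg, LinearMap.mulLeft_apply, mul_left_comm]⟩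
    rcases eq_or_ne g 0 with rfl | hg0
    · simp
    rw [mem_degreeLT, ← natDegree_lt_iff_degree_lt hg0] at hg
    rw [SetLike.mem_coe, mem_degreeLT, ← natDegree_lt_iff_degree_lt (mul_ne_zero (by simp) hg0),
      natDegree_X_pow_mul _ hg0]
    omega
  calc _ ≤ _ := Submodule.finrank_mono hle
    _ ≤ _ := Submodule.finrank_map_le _ _
    _ = _ := finrank_degreeLT _

/-- Forms of degrees `N` and `N - 1` have a common factor of degree `d` if and only if the row
spaces in the appropriate degrees, of all forms and of those of degree `N`, are small. -/
lemma hasCommonFactor_iff_finrank_rowSpace_lt [IsAlgClosed K] {κ : Type*} (e : κ → ι)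
    (hf : ∀ i, f i ∈ degreeLT K (n i + 1)) {N d : ℕ} (hd : 1 ≤ d) (hdN : d ≤ N)
    (hn : ∀ i, n i = N ∨ n i + 1 = N) (he : ∀ i, n i = N ↔ i ∈ Set.range e) :
    HasCommonFactor n f d ↔
      Module.finrank K (rowSpace n f (2 * N - d - 1)) < 2 * (N - d) + 1 ∧
      Module.finrank K (rowSpace (fun _ : κ => N) (f ∘ e) (2 * N - d)) < 2 * (N - d) + 2 := by
  obtain ⟨c, rfl⟩ := Nat.exists_eq_add_of_le hdN
  have hne : ∀ k, n (e k) = d + c := fun k => (he _).2 ⟨k, rfl⟩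
  constructor
  · intro h
    have h' : HasCommonFactor (fun _ : κ => d + c) (f ∘ e) d := by
      obtain ⟨D, hD, hDf⟩ := h
      refine ⟨D, hD, fun k => ?_⟩
      rw [← hne k]
      exact hDf (e k)
    have h1 := h.finrank_rowSpace_le (2 * (d + c) - d - 1)
    have h2 := h'.finrank_rowSpace_le (2 * (d + c) - d)
    omega
  · rintro ⟨h1, h2⟩
    by_cases hU : ∃ i, n i + 1 = d + c ∧ f i ≠ 0
    · obtain ⟨i, hi, hi0⟩ := hU
      have hmem : X ^ 0 * f i ∈ rowSpace n f (d + c - 1) := X_pow_mul_mem_rowSpace (by omega)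
      have hbot : rowSpace n f (d + c - 1) ≠ ⊥ := fun h => by
        rw [h] at hmem; simp at hmem; exact hi0 hmem
      have hfd := finiteDimensional_of_le_degreeLT (rowSpace_le_degreeLT hf (d + c - 1))
      have hpos : Module.finrank K (rowSpace n f (d + c - 1)) ≠ 0 := fun h =>
        hbot (Submodule.finrank_eq_zero.1 h)
      rw [show 2 * (d + c) - d - 1 = d + c - 1 + c by omega] at h1
      obtain ⟨G, hG, hGf⟩ := exists_common_factor_of_finrank_rowSpace_lt hf (d + c - 1) c
        (fun i => by have := hn i; omega) hbot (by omega)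
      refine hasCommonFactor_of_dvd hf hG fun i => (hGf i).imp fun g hg => ⟨hg.1, ?_⟩
      exact degreeLT_mono (by omega) hg.2
    · push Not at hU
      suffices h : HasCommonFactor (fun _ : κ => d + c) (f ∘ e) d by
        obtain ⟨D, hD, hDf⟩ := h
        refine ⟨D, hD, fun i => ?_⟩
        rcases hn i with hi | hi
        · obtain ⟨k, rfl⟩ := (he i).1 hi
          rw [hi]
          exact hDf k
        · exact ⟨0, zero_mem _, by rw [hU i hi, mul_zero]⟩
      have hf' : ∀ k, (f ∘ e) k ∈ degreeLT K (d + c + 1) := fun k => by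
        rw [← hne k]; exact hf (e k)
      set V := rowSpace (fun _ : κ => d + c) (f ∘ e) (d + c) with hV
      have hmem : ∀ k, f (e k) ∈ V := fun k => by
        simpa using X_pow_mul_mem_rowSpace (n := fun _ : κ => d + c) (f := f ∘ e)
          (l := d + c) (t := 0) (i := k) (by simp)
      have hfd : FiniteDimensional K V :=
        finiteDimensional_of_le_degreeLT (rowSpace_le_degreeLT hf' (d + c))
      rw [show 2 * (d + c) - d = d + c + c by omega] at h2
      rcases lt_trichotomy (Module.finrank K V) 1 with h | h | h
      · rw [Nat.lt_one_iff, Submodule.finrank_eq_zero] at h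
        refine ⟨0, by simp, fun k => ⟨0, zero_mem _, ?_⟩⟩
        have := hmem k
        rw [h] at this
        simpa using this
      · obtain ⟨G, hG0, hG⟩ := finrank_eq_one_iff'.1 h
        refine hasCommonFactor_of_dvd hf' (G := G) (by simpa using hG0) fun k => ?_
        obtain ⟨a, ha⟩ := hG ⟨_, hmem k⟩
        refine ⟨C a, ?_, ?_⟩
        · rw [mul_comm, ← smul_eq_C_mul]
          exact (congrArg Subtype.val ha).symm
        · rw [mem_degreeLT]
          exact degree_C_le.trans_lt (Nat.cast_pos.2 (by omega))
      · obtain ⟨G, hG, hGf⟩ := exists_common_factor_of_finrank_rowSpace_lt hf' (d + c) c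
          (fun _ => by omega) (fun h0 => by rw [← hV] at h0; rw [h0] at h; simp at h)
          (by rw [← hV]; omega)
        refine hasCommonFactor_of_dvd hf' hG fun i => (hGf i).imp fun g hg => ⟨hg.1, ?_⟩
        exact degreeLT_mono (by omega) hg.2

end Gap

end Polynomial

open Polynomial

/-- The dehomogenization `q(1, X)` of a binary form `q` of formal degree `N`. -/
noncomputable def formPoly (N : ℕ) (q : MvPolynomial (Fin 2) ℂ) : ℂ[X] :=
  ∑ b ∈ Finset.range (N + 1), monomial b (coeffOf q (N - b) b)

lemma coeff_formPoly (N : ℕ) (q : MvPolynomial (Fin 2) ℂ) (j : ℕ) :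
    (formPoly N q).coeff j = if j ≤ N then coeffOf q (N - j) j else 0 := by
  simp [formPoly, finsetSum_coeff, coeff_monomial]

lemma formPoly_mem_degreeLT (N : ℕ) (q : MvPolynomial (Fin 2) ℂ) :
    formPoly N q ∈ degreeLT ℂ (N + 1) := by
  rw [degreeLT_succ_eq_degreeLE, mem_degreeLE, degree_le_iff_coeff_zero]
  intro m hm
  rw [coeff_formPoly, if_neg (by simpa using hm)]

/-- The binary form of degree `N` with dehomogenization `f`. -/
noncomputable def binaryForm (N : ℕ) (f : ℂ[X]) : MvPolynomial (Fin 2) ℂ :=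
  ∑ j ∈ Finset.range (N + 1),
    MvPolynomial.monomial (Finsupp.single 0 (N - j) + Finsupp.single 1 j) (f.coeff j)

lemma coeff_binaryForm (N : ℕ) (f : ℂ[X]) (m : Fin 2 →₀ ℕ) :
    (binaryForm N f).coeff m = if m 0 + m 1 = N then f.coeff (m 1) else 0 := by
  have key : ∀ j ∈ Finset.range (N + 1),
      MvPolynomial.coeff m (MvPolynomial.monomial
        (Finsupp.single (0 : Fin 2) (N - j) + Finsupp.single 1 j) (f.coeff j)) =
      if j = m 1 then (if m 0 + m 1 = N then f.coeff (m 1) else 0) else 0 := by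
    intro j hj
    rw [Finset.mem_range] at hj
    rw [MvPolynomial.coeff_monomial]
    by_cases h : Finsupp.single (0 : Fin 2) (N - j) + Finsupp.single 1 j = m
    · subst h
      simp
      omega
    · rw [if_neg h]
      split_ifs with h1 h2
      · exfalso
        refine h (Finsupp.ext fun i => ?_)
        fin_cases i
        · simp; omega
        · simp [h1]
      · rfl
      · rfl
  rw [binaryForm, MvPolynomial.coeff_sum, Finset.sum_congr rfl key, Finset.sum_ite_eq']
  simp only [Finset.mem_range]
  split_ifs <;> first | rfl | omega

lemma isHomogeneous_binaryForm (N : ℕ) (f : ℂ[X]) : (binaryForm N f).IsHomogeneous N := by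
  intro m hm
  rw [coeff_binaryForm] at hm
  have : m 0 + m 1 = N := by
    by_contra h
    exact hm (if_neg h)
  simpa [Finsupp.weight_apply, Finsupp.sum_fintype, Fin.sum_univ_two] using this

lemma binaryForm_formPoly {N : ℕ} {F : MvPolynomial (Fin 2) ℂ} (hF : F.IsHomogeneous N) :
    binaryForm N (formPoly N F) = F := by
  ext m
  rw [coeff_binaryForm, coeff_formPoly]
  split_ifs with h1 h2
  · rw [coeffOf]
    congr 1
    refine Finsupp.ext fun i => ?_
    fin_cases i
    · simp; omega
    · simp
  · omega
  · by_contra h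
    have := hF (Ne.symm h)
    simp [Finsupp.weight_apply, Finsupp.sum_fintype, Fin.sum_univ_two] at this
    omega

/-- Evaluation at `(1, X)`. -/
noncomputable def dehom : MvPolynomial (Fin 2) ℂ →ₐ[ℂ] ℂ[X] := MvPolynomial.aeval ![1, X]

lemma dehom_binaryForm {N : ℕ} {f : ℂ[X]} (hf : f ∈ degreeLT ℂ (N + 1)) :
    dehom (binaryForm N f) = f := by
  have hN : f.natDegree < N + 1 := by
    rcases eq_or_ne f 0 with rfl | h
    · simp
    · rwa [mem_degreeLT, ← natDegree_lt_iff_degree_lt h] at hf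
  conv_rhs => rw [f.as_sum_range_C_mul_X_pow' hN]
  simp [binaryForm, dehom, MvPolynomial.aeval_monomial, Finsupp.prod_fintype]

lemma dehom_eq_formPoly {N : ℕ} {F : MvPolynomial (Fin 2) ℂ} (hF : F.IsHomogeneous N) :
    dehom F = formPoly N F := by
  conv_lhs => rw [← binaryForm_formPoly hF]
  exact dehom_binaryForm (formPoly_mem_degreeLT N F)

lemma dehom_injOn {N : ℕ} {F G : MvPolynomial (Fin 2) ℂ} (hF : F.IsHomogeneous N)
    (hG : G.IsHomogeneous N) (h : dehom F = dehom G) : F = G := by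
  rw [← binaryForm_formPoly hF, ← binaryForm_formPoly hG, ← dehom_eq_formPoly hF,
    ← dehom_eq_formPoly hG, h]

lemma coeff_formPoly_of_not_dvd {s : ℕ} {F : MvPolynomial (Fin 2) ℂ} (hmono : MonoS s F) (N : ℕ)
    {j : ℕ} (hj : ¬ s ∣ j) : (formPoly N F).coeff j = 0 := by
  rw [coeff_formPoly]
  split_ifs
  · by_contra h0
    have := (hmono _ (MvPolynomial.mem_support_iff.2 h0)).2
    simp at this
    exact hj this
  · rfl

/-- The dehomogenization of a form in `x ^ s` and `y ^ s`. -/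
lemma dehom_eq_expand {s n : ℕ} (hs : 0 < s) {F G : MvPolynomial (Fin 2) ℂ}
    (hF : F.IsHomogeneous (s * n)) (hmono : MonoS s F)
    (hG : ∀ a b, coeffOf G a b = coeffOf F (s * a) (s * b)) :
    dehom F = expand ℂ s (formPoly n G) := by
  rw [dehom_eq_formPoly hF]
  ext j
  rw [coeff_formPoly, coeff_expand hs]
  by_cases hj : s ∣ j
  · obtain ⟨b, rfl⟩ := hj
    rw [if_pos (dvd_mul_right s b), Nat.mul_div_cancel_left b hs, coeff_formPoly, hG,
      Nat.mul_sub]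
    simp only [Nat.mul_le_mul_left_iff hs]
  · rw [if_neg hj, ← coeff_formPoly, coeff_formPoly_of_not_dvd hmono _ hj]

lemma monoS_binaryForm_expand {s : ℕ} (hs : 0 < s) (n : ℕ) (f : ℂ[X]) :
    MonoS s (binaryForm (s * n) (expand ℂ s f)) := by
  intro m hm
  rw [MvPolynomial.mem_support_iff, coeff_binaryForm, coeff_expand hs] at hm
  split_ifs at hm with h1 h2
  · exact ⟨(Nat.dvd_add_left h2).1 (h1 ▸ dvd_mul_right s n), h2⟩
  · simp at hm
  · simp at hm

lemma expand_mem_degreeLT (s : ℕ) {d : ℕ} {D : ℂ[X]} (hD : D.natDegree ≤ d) :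
    expand ℂ s D ∈ degreeLT ℂ (s * d + 1) := by
  rw [degreeLT_succ_eq_degreeLE, mem_degreeLE]
  refine degree_le_natDegree.trans (Nat.cast_le.2 ?_)
  rw [natDegree_expand, mul_comm]
  exact Nat.mul_le_mul_left s hD

/-- Membership in `F((k₁, k₂), (s₁, 1))` in terms of the dehomogenization. -/
lemma mem_Fset_two_iff {k1 k2 s : ℕ} (hs : 0 < s) {P : MvPolynomial (Fin 2) ℂ}
    (hP : P.IsHomogeneous (k1 - 1 + s * (k2 - 1))) :
    P ∈ Fset 2 (fun i => if i = 0 then k1 else k2) (fun i => if i = 0 then s else 1) ↔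
      ∃ D H : ℂ[X], D.natDegree ≤ k2 - 1 ∧ H ∈ degreeLT ℂ (k1 - 1 + 1) ∧
        dehom P = H * expand ℂ s D := by
  constructor
  · rintro ⟨Q, hPQ, hQ⟩
    obtain ⟨h0, -⟩ := hQ 0 (by norm_num)
    obtain ⟨h1, hm⟩ := hQ 1 (by norm_num)
    simp only [Sp, Finset.range_zero, Finset.prod_empty, one_mul, if_true, Finset.range_one,
      Finset.prod_singleton, one_ne_zero, if_false] at h0 h1 hm
    have hcontract : dehom (Q 1) = expand ℂ s (contract s (dehom (Q 1))) := by
      ext j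
      rw [coeff_expand hs]
      split_ifs with hj
      · obtain ⟨b, rfl⟩ := hj
        rw [Nat.mul_div_cancel_left b hs, coeff_contract hs.ne', mul_comm]
      · rw [dehom_eq_formPoly h1, coeff_formPoly_of_not_dvd hm _ hj]
    refine ⟨contract s (dehom (Q 1)), dehom (Q 0), ?_, ?_, ?_⟩
    · rw [natDegree_le_iff_coeff_eq_zero]
      intro b hb
      rw [coeff_contract hs.ne', dehom_eq_formPoly h1, coeff_formPoly, if_neg]
      rw [mul_comm, Nat.mul_le_mul_left_iff hs]
      omega
    · rw [dehom_eq_formPoly h0]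
      exact formPoly_mem_degreeLT _ _
    · rw [← hcontract, hPQ, ← map_mul]
      simp [Finset.prod_range_succ]
  · rintro ⟨D, H, hD, hH, hPDH⟩
    refine ⟨fun i => if i = 0 then binaryForm (k1 - 1) H else
      binaryForm (s * (k2 - 1)) (expand ℂ s D), ?_, ?_⟩
    · refine dehom_injOn hP ?_ ?_
      · simp only [Finset.prod_range_succ, Finset.range_zero, Finset.prod_empty, one_mul, if_true,
          one_ne_zero, if_false]
        exact (isHomogeneous_binaryForm _ _).mul (isHomogeneous_binaryForm _ _)
      · simp only [Finset.prod_range_succ, Finset.range_zero, Finset.prod_empty, one_mul, if_true,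
          one_ne_zero, if_false, map_mul]
        rw [dehom_binaryForm hH, dehom_binaryForm (expand_mem_degreeLT s hD), hPDH]
    · intro i hi
      interval_cases i
      · simpa [Sp, MonoS] using isHomogeneous_binaryForm (k1 - 1) H
      · simpa [Sp] using ⟨isHomogeneous_binaryForm (s * (k2 - 1)) (expand ℂ s D),
          monoS_binaryForm_expand hs (k2 - 1) D⟩

/-- The coefficients of a polynomial assembled from components in the residue classes `ρ i`. -/
lemma coeff_sum_X_pow_mul_expand {s : ℕ} {ρ : Fin s → ℕ} (hρ : ∀ i, ρ i < s)
    (hinj : Function.Injective ρ) (u : Fin s → ℂ[X]) (i : Fin s) (b : ℕ) :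
    (∑ j, X ^ ρ j * expand ℂ s (u j)).coeff (s * b + ρ i) = (u i).coeff b := by
  have hs : 0 < s := i.pos
  rw [finsetSum_coeff, Finset.sum_eq_single i]
  · rw [coeff_X_pow_mul, coeff_expand_mul' hs]
  · intro j _ hji
    rw [coeff_X_pow_mul']
    split_ifs with h
    · rw [coeff_expand hs, if_neg]
      intro hdvd
      refine hji (hinj ?_)
      have h1 := (Nat.modEq_iff_dvd' h).2 hdvd
      have h2 : s * b + ρ i ≡ ρ i [MOD s] := by simp [Nat.ModEq]
      exact (h1.trans h2).eq_of_lt_of_lt (hρ j) (hρ i)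
    · rfl
  · simp

/-- Every polynomial is assembled from its components in the residue classes modulo `s`. -/
lemma exists_eq_sum_X_pow_mul_expand {s : ℕ} (hs : 0 < s) {ρ : Fin s → ℕ} (hρ : ∀ i, ρ i < s)
    (hinj : Function.Injective ρ) (f : ℂ[X]) :
    ∃ u : Fin s → ℂ[X], f = ∑ j, X ^ ρ j * expand ℂ s (u j) := by
  let u : Fin s → ℂ[X] := fun j =>
    ∑ b ∈ Finset.range (f.natDegree + 1), monomial b (f.coeff (s * b + ρ j))
  have hu : ∀ j b, (u j).coeff b = f.coeff (s * b + ρ j) := fun j b => by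
    simp only [u, finsetSum_coeff, coeff_monomial, Finset.sum_ite_eq', Finset.mem_range]
    split_ifs with h
    · rfl
    · rw [coeff_eq_zero_of_natDegree_lt]
      nlinarith
  refine ⟨u, ?_⟩
  ext m
  have hsurj : Function.Surjective fun i => (⟨ρ i, hρ i⟩ : Fin s) :=
    Finite.surjective_of_injective fun i j h => hinj (congrArg Fin.val h)
  obtain ⟨i, hi⟩ := hsurj ⟨m % s, Nat.mod_lt m hs⟩
  have hi : ρ i = m % s := congrArg Fin.val hi
  rw [← Nat.div_add_mod m s, ← hi, coeff_sum_X_pow_mul_expand hρ hinj, hu]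

/-- A polynomial has a factor in `X ^ s` if and only if its components have a common factor. -/
lemma exists_factor_expand_iff {s d k : ℕ} (hs : 0 < s) (hd : 1 ≤ d) {n : Fin s → ℕ}
    (hn : ∀ i, n i = (k + s * d - i) / s) {f : Fin s → ℂ[X]} {P : ℂ[X]}
    (hP : P = ∑ i : Fin s, X ^ ((k + s * d - i) % s) * expand ℂ s (f i)) :
    (∃ D H : ℂ[X], D.natDegree ≤ d ∧ H ∈ degreeLT ℂ (k + 1) ∧ P = H * expand ℂ s D) ↔
      HasCommonFactor n f d := by
  have hsd : s ≤ s * d := Nat.le_mul_of_pos_right s hd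
  set ρ : Fin s → ℕ := fun i => (k + s * d - i) % s with hρdef
  have hρ : ∀ i, ρ i < s := fun i => Nat.mod_lt _ hs
  have hinj : Function.Injective ρ := fun i j hij => by
    have h1 : k + s * d - i ≡ k + s * d - j [MOD s] := hij
    have hi := i.2
    have hj := j.2
    have h2 : (k + s * d - i) + i ≡ (k + s * d - j) + j [MOD s] := by
      rw [Nat.sub_add_cancel (by omega), Nat.sub_add_cancel (by omega)]
    exact Fin.ext ((h1.add_left_cancel h2).eq_of_lt_of_lt hi hj)
  have hdiv : ∀ i : Fin s, s * n i + ρ i + i = k + s * d := fun i => by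
    rw [hn]
    have : s * ((k + s * d - i) / s) + ρ i = k + s * d - i := Nat.div_add_mod (k + s * d - i) s
    have := i.2
    omega
  have hmul : ∀ (D : ℂ[X]) (u : Fin s → ℂ[X]), (∑ i, X ^ ρ i * expand ℂ s (u i)) * expand ℂ s D =
      ∑ i, X ^ ρ i * expand ℂ s (D * u i) := fun D u => by
    rw [Finset.sum_mul]
    exact Finset.sum_congr rfl fun i _ => by rw [map_mul]; ring
  constructor
  · rintro ⟨D, H, hD, hH, hPDH⟩
    obtain ⟨u, rfl⟩ := exists_eq_sum_X_pow_mul_expand hs hρ hinj H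
    refine ⟨D, hD, fun i => ⟨u i, ?_, ?_⟩⟩
    · rw [mem_degreeLT, degree_lt_iff_coeff_zero]
      intro b hb
      rw [← coeff_sum_X_pow_mul_expand hρ hinj u i b]
      rw [mem_degreeLT, degree_lt_iff_coeff_zero] at hH
      refine hH _ ?_
      have h1 := hdiv i
      have h2 := i.2
      have h3 : s * (n i + 1) ≤ s * (b + d) := Nat.mul_le_mul_left s (by omega)
      rw [mul_add, mul_add] at h3
      omega
    · ext b
      rw [← coeff_sum_X_pow_mul_expand hρ hinj f i b, ← hP, hPDH, hmul,
        coeff_sum_X_pow_mul_expand hρ hinj]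
  · rintro ⟨D, hD, h⟩
    choose u hu hfu using h
    refine ⟨D, ∑ i, X ^ ρ i * expand ℂ s (u i), hD, ?_, ?_⟩
    · refine sum_mem fun i _ => ?_
      rcases eq_or_ne (u i) 0 with h0 | h0
      · simp [h0]
      have hui := hu i
      rw [mem_degreeLT, ← natDegree_lt_iff_degree_lt h0] at hui
      refine degreeLT_mono ?_ (mul_mem_degreeLT (natDegree_X_pow_le (ρ i))
        (expand_mem_degreeLT s le_rfl))
      have h1 := hdiv i
      have h3 : s * ((u i).natDegree + d) ≤ s * n i := Nat.mul_le_mul_left s (by omega)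
      rw [mul_add] at h3
      omega
    · rw [hmul, hP]
      exact Finset.sum_congr rfl fun i _ => by rw [hfu i]

/-- The rank of a resultant matrix is the dimension of the associated space of forms. -/
lemma rank_resMat {ι : Type} [Fintype ι] (n : ι → ℕ) (q : ι → MvPolynomial (Fin 2) ℂ) (l : ℕ) :
    (resMat n q l).rank = Module.finrank ℂ (rowSpace n (fun i => formPoly (n i) (q i)) l) := by
  set f : ι → ℂ[X] := fun i => formPoly (n i) (q i) with hf
  let φ : ℂ[X] →ₗ[ℂ] (Fin (l + 1) → ℂ) := LinearMap.pi fun c => lcoeff ℂ c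
  have hrow : Set.range (resMat n q l).row =
      φ '' Set.range fun x : (i : ι) × Fin (l + 1 - n i) => X ^ (x.2 : ℕ) * f x.1 := by
    rw [← Set.range_comp]
    congr 1
    ext x c
    simp only [Matrix.row, resMat, φ, f, Function.comp_apply, LinearMap.pi_apply, lcoeff_apply,
      coeff_X_pow_mul', coeff_formPoly]
    split_ifs <;> first | rfl | omega
  rw [Matrix.rank_eq_finrank_span_row, hrow, Submodule.span_image]
  change Module.finrank ℂ ((rowSpace n f l).map φ) = _
  rw [← LinearMap.range_domRestrict]
  refine LinearMap.finrank_range_of_inj ?_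
  rw [← LinearMap.ker_eq_bot, LinearMap.ker_eq_bot']
  rintro ⟨g, hg⟩ h
  have hg' := rowSpace_le_degreeLT (fun i => formPoly_mem_degreeLT (n i) (q i)) l hg
  rw [mem_degreeLT, degree_lt_iff_coeff_zero] at hg'
  ext m
  by_cases hm : m < l + 1
  · exact congrFun h ⟨m, hm⟩
  · exact hg' m (by omega)

theorem stmt_8 (k1 k2 s1 : ℕ) (hk1 : 1 ≤ k1) (hk2 : 2 ≤ k2) (hs1 : 2 ≤ s1)
    (K : ℕ) (hK : K = k1 + s1 * (k2 - 1))
    (nstar : ℕ) (hnstar : nstar = (K - 1) / s1)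
    (A : Fin K → ℂ) (P : MvPolynomial (Fin 2) ℂ)
    (hP : P = ∑ j : Fin K,
      MvPolynomial.C (A j) * MvPolynomial.X 0 ^ (K - 1 - j.val) * MvPolynomial.X 1 ^ j.val)
    -- the s₁-decomposition (p 0, …, p (s₁-1)) = σ_{s₁}(P)
    (p : Fin s1 → MvPolynomial (Fin 2) ℂ) (hp : IsSigma s1 (K - 1) P p)
    -- q i is obtained from p i by the substitution x^{s₁} → x, y^{s₁} → y
    (q : Fin s1 → MvPolynomial (Fin 2) ℂ)
    (hq : ∀ (i : Fin s1) (a b : ℕ), coeffOf (q i) a b = coeffOf (p i) (s1 * a) (s1 * b))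
    -- the formal degrees n i = ⌊(K-1-i)/s₁⌋ (each equals nstar or nstar - 1)
    (nn : Fin s1 → ℕ) (hnn : ∀ i, nn i = (K - 1 - i.val) / s1)
    -- r is the number of indices with formal degree nstar
    (r : ℕ) (hr1 : r ≤ s1) (hr2 : ∀ i : Fin s1, nn i = nstar ↔ i.val < r)
    (l1 l2 z1 z2 : ℕ) (hl1 : l1 = 2 * nstar - k2) (hl2 : l2 = 2 * nstar + 1 - k2)
    (hz1 : z1 = 2 * nstar + 3 - 2 * k2) (hz2 : z2 = 2 * nstar + 4 - 2 * k2) :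
    P ∈ Fset 2 (fun i => if i = 0 then k1 else k2) (fun i => if i = 0 then s1 else 1) ↔
    ((∀ (ri : Fin z1 → ((i : Fin s1) × Fin (l1 + 1 - nn i))) (ci : Fin z1 → Fin (l1 + 1)),
        ((resMat nn q l1).submatrix ri ci).det = 0) ∧
     (∀ (ri : Fin z2 → ((i : Fin r) × Fin (l2 + 1 - nstar))) (ci : Fin z2 → Fin (l2 + 1)),
        ((resMat (fun _ : Fin r => nstar)
            (fun i : Fin r => q ⟨i.val, lt_of_lt_of_le i.isLt hr1⟩) l2).submatrix ri ci).det
          = 0)) := by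
  have hs : 0 < s1 := by omega
  have hsd : s1 ≤ s1 * (k2 - 1) := Nat.le_mul_of_pos_right s1 (by omega)
  have hK1 : K - 1 = k1 - 1 + s1 * (k2 - 1) := by omega
  have hPhom : P.IsHomogeneous (K - 1) := by
    rw [hP]
    refine MvPolynomial.IsHomogeneous.sum _ _ _ fun j _ => ?_
    have h := ((MvPolynomial.isHomogeneous_C (Fin 2) (A j)).mul
      ((MvPolynomial.isHomogeneous_X ℂ (0 : Fin 2)).pow (K - 1 - j))).mul
      ((MvPolynomial.isHomogeneous_X ℂ (1 : Fin 2)).pow j)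
    have hj := j.2
    rwa [show 0 + 1 * (K - 1 - j) + 1 * j = K - 1 by omega] at h
  have hPf : dehom P = ∑ i : Fin s1, X ^ ((K - 1 - i) % s1) *
      expand ℂ s1 (formPoly (nn i) (q i)) := by
    rw [hp.2, map_sum]
    refine Finset.sum_congr rfl fun i _ => ?_
    obtain ⟨hhom, hmono, -⟩ := hp.1 i
    rw [← hnn i] at hhom
    rw [map_mul, dehom_eq_expand hs hhom hmono (hq i)]
    simp [dehom]
  have hn : ∀ i, nn i = nstar ∨ nn i + 1 = nstar := fun i => by
    have hi := i.2
    have h1 : nn i ≤ nstar := by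
      rw [hnn, hnstar]
      exact Nat.div_le_div_right (by omega)
    have h2 : nstar ≤ nn i + 1 := by
      rw [hnn, hnstar, ← Nat.add_div_right _ hs]
      exact Nat.div_le_div_right (by omega)
    omega
  have hdn : k2 - 1 ≤ nstar := by
    rw [hnstar, Nat.le_div_iff_mul_le hs, mul_comm]
    omega
  let e : Fin r → Fin s1 := fun i => ⟨i, lt_of_lt_of_le i.isLt hr1⟩
  have he : ∀ i, nn i = nstar ↔ i ∈ Set.range e := fun i => by
    rw [hr2]
    exact ⟨fun h => ⟨⟨i, h⟩, rfl⟩, by rintro ⟨j, rfl⟩; exact j.2⟩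
  have htop : (fun i : Fin r => formPoly nstar (q (e i))) =
      (fun i => formPoly (nn i) (q i)) ∘ e := funext fun i => by
    rw [Function.comp_apply, (he (e i)).2 ⟨i, rfl⟩]
  rw [Matrix.forall_minor_eq_zero_iff, Matrix.forall_minor_eq_zero_iff, rank_resMat, rank_resMat,
    htop, mem_Fset_two_iff hs (hK1 ▸ hPhom)]
  rw [hK1] at hnn hPf
  rw [exists_factor_expand_iff hs (by omega) hnn hPf,
    hasCommonFactor_iff_finrank_rowSpace_lt e (fun i => formPoly_mem_degreeLT (nn i) (q i))
      (by omega) hdn hn he]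
  rw [show 2 * nstar - (k2 - 1) - 1 = l1 by omega, show 2 * nstar - (k2 - 1) = l2 by omega,
    show 2 * (nstar - (k2 - 1)) + 1 = z1 by omega, show 2 * (nstar - (k2 - 1)) + 2 = z2 by omega]
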